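/- Let P be a row-stochastic matrix on a finite set S and let i ∈ S be a state that belongs to no closed communicating class of P. Then every stationary distribution π of P satisfies π(i) = 0. -/

import Mathlib

open Filter Topology

/-- A matrix is row-stochastic: nonnegative entries and each row sums to 1. -/
def RowStochastic {S : Type*} [Fintype S] (P : Matrix S S ℝ) : Prop :=
  (∀ i j, 0 ≤ P i j) ∧ ∀ i, ∑ j, P i j = 1

/-- A probability row vector `π` is a stationary distribution of `P`. -/
def StationaryDist {S : Type*} [Fintype S] (P : Matrix S S ℝ) (π : S → ℝ) : Prop :=
  (∀ i, 0 ≤ π i) ∧ (∑ i, π i = 1) ∧ ∀ j, ∑ i, π i * P i j = π j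

/-- A closed communicating class: a nonempty set which no transition leaves, and
within which every state leads to every other in some number `k ≥ 1` of steps. -/
def ClosedClass {S : Type*} [Fintype S] [DecidableEq S] (P : Matrix S S ℝ) (C : Set S) : Prop :=
  C.Nonempty ∧ (∀ i ∈ C, ∀ j, j ∉ C → P i j = 0) ∧
    ∀ i ∈ C, ∀ j ∈ C, ∃ k, 1 ≤ k ∧ 0 < (P ^ k) i j


lemma rs_pow {S : Type*} [Fintype S] [DecidableEq S] {P : Matrix S S ℝ}
    (hP : RowStochastic P) (k : ℕ) : RowStochastic (P ^ k) := by
  induction k with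
  | zero =>
    refine ⟨fun i j => ?_, fun i => ?_⟩
    · rw [pow_zero, Matrix.one_apply]; split_ifs <;> norm_num
    · simp [Matrix.one_apply]
  | succ k ih =>
    refine ⟨fun i j => ?_, fun i => ?_⟩
    · rw [pow_succ, Matrix.mul_apply]
      exact Finset.sum_nonneg fun x _ => mul_nonneg (ih.1 _ _) (hP.1 _ _)
    · simp only [pow_succ, Matrix.mul_apply]
      rw [Finset.sum_comm]
      simp only [← Finset.mul_sum, hP.2, mul_one, ih.2]

lemma sd_pow {S : Type*} [Fintype S] [DecidableEq S] {P : Matrix S S ℝ} {π : S → ℝ}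
    (h : StationaryDist P π) (k : ℕ) : StationaryDist (P ^ k) π := by
  refine ⟨h.1, h.2.1, ?_⟩
  induction k with
  | zero => intro j; simp [Matrix.one_apply]
  | succ k ih =>
    intro j
    simp only [pow_succ, Matrix.mul_apply, Finset.mul_sum]
    rw [Finset.sum_comm]
    simp only [← mul_assoc, ← Finset.sum_mul, ih, h.2.2]

lemma pow_trans {S : Type*} [Fintype S] [DecidableEq S] {P : Matrix S S ℝ}
    (hP : RowStochastic P) {k m : ℕ} {a b c : S} (h1 : 0 < (P ^ k) a b)
    (h2 : 0 < (P ^ m) b c) : 0 < (P ^ (k + m)) a c := by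
  rw [pow_add, Matrix.mul_apply]
  exact Finset.sum_pos' (fun x _ => mul_nonneg ((rs_pow hP k).1 _ _) ((rs_pow hP m).1 _ _))
    ⟨b, Finset.mem_univ _, mul_pos h1 h2⟩

lemma rs_exists {S : Type*} [Fintype S] {P : Matrix S S ℝ}
    (hP : RowStochastic P) (a : S) : ∃ b, 0 < P a b := by
  by_contra! h
  have := hP.2 a
  have h2 := Finset.sum_nonpos (s := Finset.univ) (fun b _ => h b)
  linarith

open Classical in
lemma no_inflow {S : Type*} [Fintype S] {Q : Matrix S S ℝ} {π : S → ℝ}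
    (hQ : RowStochastic Q) (h : StationaryDist Q π) (D : Set S)
    (hD : ∀ a ∈ D, ∀ b, b ∉ D → Q a b = 0) {a b : S} (ha : a ∉ D) (hb : b ∈ D) :
    π a * Q a b = 0 := by
  have e1 : ∑ y, (if y ∈ D then π y else 0) = ∑ x, π x * ∑ y, (if y ∈ D then Q x y else 0) := by
    simp only [Finset.mul_sum]
    rw [Finset.sum_comm]
    refine Finset.sum_congr rfl fun y _ => ?_
    split_ifs with hy
    · exact (h.2.2 y).symm
    · simp
  have nn : ∀ x y, 0 ≤ (if y ∈ D then Q x y else 0) := fun x y => by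
    split_ifs
    · exact hQ.1 _ _
    · exact le_rfl
  have e2 : ∀ x, 0 ≤ π x * ∑ y, (if y ∈ D then Q x y else 0) - (if x ∈ D then π x else 0) := by
    intro x
    split_ifs with hx
    · have : ∑ y, (if y ∈ D then Q x y else 0) = 1 := by
        rw [← hQ.2 x]
        refine Finset.sum_congr rfl fun y _ => ?_
        split_ifs with hy
        · rfl
        · exact (hD x hx y hy).symm
      rw [this]; simp
    · rw [sub_zero]
      exact mul_nonneg (h.1 x) (Finset.sum_nonneg fun y _ => nn x y)
  have e3 : ∑ x, (π x * ∑ y, (if y ∈ D then Q x y else 0) - (if x ∈ D then π x else 0)) = 0 := by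
    rw [Finset.sum_sub_distrib, ← e1, sub_self]
  have e4 := (Finset.sum_eq_zero_iff_of_nonneg (fun x _ => e2 x)).1 e3 a (Finset.mem_univ _)
  rw [if_neg ha, sub_zero] at e4
  refine le_antisymm ?_ (mul_nonneg (h.1 a) (hQ.1 a b))
  rw [← e4]
  refine mul_le_mul_of_nonneg_left ?_ (h.1 a)
  have := Finset.single_le_sum (fun y _ => nn a y) (Finset.mem_univ b)
  simpa only [if_pos hb] using this

/-- A state belonging to no closed communicating class (a transient state) has zero
probability under every stationary distribution. -/
theorem stationary_vanishes_on_transient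
    {S : Type*} [Fintype S] [DecidableEq S] [Nonempty S]
    (P : Matrix S S ℝ) (hP : RowStochastic P)
    (i : S) (hi : ∀ C : Set S, ClosedClass P C → i ∉ C) :
    ∀ π : S → ℝ, StationaryDist P π → π i = 0 := by
  intro π h
  by_contra hne
  have back : ∀ j k, 0 < (P ^ k) i j → ∃ m, 1 ≤ m ∧ 0 < (P ^ m) j i := by
    intro j k hk
    by_contra hni
    obtain ⟨l, hl⟩ := rs_exists hP j
    have hl1 : 0 < (P ^ 1) j l := by simpa using hl
    have hil := pow_trans hP hk hl1
    have := no_inflow (rs_pow hP (k + 1)) (sd_pow h (k + 1))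
      {x | ∃ m, 1 ≤ m ∧ 0 < (P ^ m) j x} (by
        rintro a ⟨m, hm, hma⟩ b hb
        by_contra hab
        exact hb ⟨m + (k + 1), by omega,
          pow_trans hP hma (lt_of_le_of_ne ((rs_pow hP _).1 _ _) (Ne.symm hab))⟩)
      (a := i) (b := l) hni ⟨1, le_rfl, hl1⟩
    rcases mul_eq_zero.1 this with h0 | h0
    · exact hne h0
    · exact hil.ne' h0
  have hii : ∃ m, 1 ≤ m ∧ 0 < (P ^ m) i i := back i 0 (by simp)
  refine hi {x | ∃ m, 1 ≤ m ∧ 0 < (P ^ m) i x} ⟨⟨i, hii⟩, ?_, ?_⟩ hii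
  · rintro a ⟨m, hm, hma⟩ b hb
    by_contra hab
    refine hb ⟨m + 1, by omega, pow_trans hP hma ?_⟩
    rw [pow_one]
    exact lt_of_le_of_ne (hP.1 _ _) (Ne.symm hab)
  · rintro a ⟨m, hm, hma⟩ b ⟨n, hn, hnb⟩
    obtain ⟨r, hr, hra⟩ := back a m hma
    exact ⟨r + n, by omega, pow_trans hP hra hnb⟩
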